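/- arXiv:1010.4199 — 5 statements merged into one kernel-verified Lean document; each statement's English description precedes it below -/
import Mathlib

section
/- Let A be a finite abelian group and B ⊆ A a subgroup. In the integral group ring ℤ[A], let β(B) be the ideal generated by {1 − b : b ∈ B} and let α(B) be the ideal generated by u_B := Σ_{b∈B} b. Then α(B) ∩ β(B) = 0, and the quotient group ℤ[A]/(α(B) + β(B)) is finite of order exactly |B|^{|A|/|B|}. -/
noncomputable section

/-- the ideal of `ℤ[A]` generated by `{1 - b : b ∈ B}`;
it is the kernel of the natural map `ℤ[A] → ℤ[A/B]`. -/
def betaIdeal (A : Type) [CommGroup A] (B : Subgroup A) : Ideal (MonoidAlgebra ℤ A) :=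
  Ideal.span ((fun b => (1 : MonoidAlgebra ℤ A) - MonoidAlgebra.of ℤ A b) '' (B : Set A))

/-- the ideal of `ℤ[A]` generated by `u_B = ∑_{b ∈ B} b`;
it is the annihilator of `betaIdeal A B`. -/
def alphaIdeal (A : Type) [CommGroup A] [Fintype A] (B : Subgroup A)
    [DecidablePred (· ∈ B)] : Ideal (MonoidAlgebra ℤ A) :=
  Ideal.span {∑ b : B, MonoidAlgebra.of ℤ A (b : A)}

section SubgroupIdeals

open MonoidAlgebra

lemma coeff_natCast_mul {R M : Type*} [Semiring R] [Monoid M] (n : ℕ) (y : MonoidAlgebra R M)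
    (m : M) : ((n : MonoidAlgebra R M) * y).coeff m = n * y.coeff m := by
  rw [← nsmul_eq_mul, ← nsmul_eq_mul]
  rfl

variable {A : Type} [CommGroup A] (B : Subgroup A)

lemma mapDomainRingHom_mk'_of (a : A) :
    mapDomainRingHom ℤ (QuotientGroup.mk' B) (of ℤ A a) = of ℤ (A ⧸ B) (a : A ⧸ B) := by
  simp

lemma mapDomainRingHom_mk'_surjective :
    Function.Surjective (mapDomainRingHom ℤ (QuotientGroup.mk' B)) := by
  intro y
  induction y using MonoidAlgebra.induction_linear with
  | zero => exact ⟨0, map_zero _⟩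
  | add f g hf hg =>
    obtain ⟨x, rfl⟩ := hf
    obtain ⟨y, rfl⟩ := hg
    exact ⟨x + y, map_add _ _ _⟩
  | single q n =>
    obtain ⟨a, rfl⟩ := QuotientGroup.mk'_surjective B q
    exact ⟨single a n, by simp⟩

lemma sub_mapDomain_out_mem_betaIdeal (x : MonoidAlgebra ℤ A) :
    x - mapDomain Quotient.out (mapDomainRingHom ℤ (QuotientGroup.mk' B) x) ∈
      betaIdeal A B := by
  induction x using MonoidAlgebra.induction_linear with
  | zero => simp
  | add f g hf hg =>
    rw [map_add, mapDomain_add, add_sub_add_comm]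
    exact add_mem hf hg
  | single a n =>
    obtain ⟨b, hb⟩ := QuotientGroup.mk_out_eq_mul B a
    have h : (single a n : MonoidAlgebra ℤ A) -
        mapDomain Quotient.out (mapDomainRingHom ℤ (QuotientGroup.mk' B) (single a n)) =
        single a n * (1 - of ℤ A (b : A)) := by
      simp only [mapDomainRingHom_apply, mapDomain_single, QuotientGroup.coe_mk', mul_sub,
        mul_one, of_apply, single_mul_single, ← hb]
    rw [h]
    exact Ideal.mul_mem_left _ _ (Ideal.subset_span ⟨b, b.2, rfl⟩)

/-- `betaIdeal A B` is the kernel of the natural map `ℤ[A] → ℤ[A/B]`. -/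
lemma ker_mapDomainRingHom_mk' :
    RingHom.ker (mapDomainRingHom ℤ (QuotientGroup.mk' B)) = betaIdeal A B := by
  apply le_antisymm
  · intro x hx
    have h := sub_mapDomain_out_mem_betaIdeal B x
    rwa [(RingHom.mem_ker).1 hx, mapDomain_zero, sub_zero] at h
  · refine Ideal.span_le.2 ?_
    rintro _ ⟨b, hb, rfl⟩
    rw [SetLike.mem_coe, RingHom.mem_ker, map_sub, map_one, mapDomainRingHom_mk'_of,
      (QuotientGroup.eq_one_iff b).2 hb, map_one, sub_self]

variable [Fintype A] [DecidablePred (· ∈ B)]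

lemma mapDomainRingHom_mk'_sum_of :
    mapDomainRingHom ℤ (QuotientGroup.mk' B) (∑ b : B, of ℤ A (b : A)) =
      (Fintype.card B : MonoidAlgebra ℤ (A ⧸ B)) := by
  rw [map_sum, Finset.sum_congr rfl fun b _ => by
    rw [mapDomainRingHom_mk'_of, (QuotientGroup.eq_one_iff (b : A)).2 b.2, map_one]]
  simp

lemma mul_sum_of_eq_zero_of_mem_betaIdeal {x : MonoidAlgebra ℤ A} (hx : x ∈ betaIdeal A B) :
    x * ∑ b : B, of ℤ A (b : A) = 0 := by
  induction hx using Submodule.span_induction with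
  | zero => simp
  | add x y _ _ hx hy => rw [add_mul, hx, hy, add_zero]
  | smul a x _ hx => rw [smul_eq_mul, mul_assoc, hx, mul_zero]
  | mem x hx =>
    obtain ⟨c, hc, rfl⟩ := hx
    rw [sub_mul, one_mul, Finset.mul_sum, sub_eq_zero]
    refine (Fintype.sum_equiv (Equiv.mulLeft (⟨c, hc⟩ : B)) _ _ fun b => ?_).symm
    simp [single_mul_single]

lemma alphaIdeal_inf_betaIdeal : alphaIdeal A B ⊓ betaIdeal A B = ⊥ := by
  rw [eq_bot_iff]
  rintro x ⟨hα, hβ⟩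
  obtain ⟨r, rfl⟩ := Ideal.mem_span_singleton'.1 hα
  refine mul_sum_of_eq_zero_of_mem_betaIdeal B ?_
  rw [SetLike.mem_coe, ← ker_mapDomainRingHom_mk', RingHom.mem_ker, map_mul,
    mapDomainRingHom_mk'_sum_of, mul_comm] at hβ
  rw [← ker_mapDomainRingHom_mk', RingHom.mem_ker]
  ext q
  have h := congrArg (fun y => y.coeff q) hβ
  rw [coeff_natCast_mul] at h
  exact (mul_eq_zero.1 h).resolve_left (Nat.cast_ne_zero.2 Fintype.card_ne_zero)

/-- The coefficients modulo `|B|` of the image of an element of `ℤ[A]` in `ℤ[A/B]`. -/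
def coeffQuotientModCard : MonoidAlgebra ℤ A →+ (A ⧸ B → ZMod (Fintype.card B)) where
  toFun x q := ((mapDomainRingHom ℤ (QuotientGroup.mk' B) x).coeff q : ZMod (Fintype.card B))
  map_zero' := by ext; simp
  map_add' x y := by ext; rw [map_add]; simp

lemma coeffQuotientModCard_surjective : Function.Surjective (coeffQuotientModCard B) := by
  intro f
  choose g hg using fun q => ZMod.intCast_surjective (f q)
  obtain ⟨x, hx⟩ := mapDomainRingHom_mk'_surjective B (.ofCoeff (Finsupp.equivFunOnFinite.symm g))
  refine ⟨x, funext fun q => ?_⟩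
  simp [coeffQuotientModCard, hx, hg, -mapDomainRingHom_apply]

lemma ker_coeffQuotientModCard :
    (coeffQuotientModCard B).ker = (alphaIdeal A B ⊔ betaIdeal A B).toAddSubgroup := by
  ext x
  rw [AddMonoidHom.mem_ker, Submodule.mem_toAddSubgroup]
  constructor
  · intro hx
    have hdvd (q : A ⧸ B) : (Fintype.card B : ℤ) ∣
        (mapDomainRingHom ℤ (QuotientGroup.mk' B) x).coeff q :=
      (ZMod.intCast_zmod_eq_zero_iff_dvd _ _).1 (congrFun hx q)
    choose g hg using hdvd
    obtain ⟨z, hz⟩ :=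
      mapDomainRingHom_mk'_surjective B (.ofCoeff (Finsupp.equivFunOnFinite.symm g))
    rw [← add_sub_cancel (z * ∑ b : B, of ℤ A (b : A)) x]
    refine Submodule.add_mem_sup (Ideal.mul_mem_left _ _ (Ideal.mem_span_singleton_self _)) ?_
    rw [← ker_mapDomainRingHom_mk', RingHom.mem_ker, map_sub, map_mul,
      mapDomainRingHom_mk'_sum_of, hz, mul_comm, sub_eq_zero]
    ext q
    rw [hg q, coeff_natCast_mul]
    rfl
  · intro hx
    obtain ⟨y, hy, z, hz, rfl⟩ := Submodule.mem_sup.1 hx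
    obtain ⟨r, rfl⟩ := Ideal.mem_span_singleton'.1 hy
    rw [← ker_mapDomainRingHom_mk', RingHom.mem_ker] at hz
    ext q
    change ((mapDomainRingHom ℤ (QuotientGroup.mk' B) _).coeff q : ZMod (Fintype.card B)) = 0
    rw [map_add, hz, add_zero, map_mul, mapDomainRingHom_mk'_sum_of, mul_comm,
      coeff_natCast_mul]
    simp [-mapDomainRingHom_apply]

/-- `ℤ[A] / (α(B) + β(B))` is additively a product of copies of `ℤ/|B|` indexed by `A/B`. -/
def quotientAlphaSupBetaEquiv :
    (MonoidAlgebra ℤ A ⧸ (alphaIdeal A B ⊔ betaIdeal A B)) ≃+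
      (A ⧸ B → ZMod (Fintype.card B)) :=
  (QuotientAddGroup.quotientAddEquivOfEq (ker_coeffQuotientModCard B).symm).trans
    (QuotientAddGroup.quotientKerEquivOfSurjective _ (coeffQuotientModCard_surjective B))

end SubgroupIdeals

theorem statement9 (A : Type) [CommGroup A] [Fintype A] (B : Subgroup A)
    [DecidablePred (· ∈ B)] :
    alphaIdeal A B ⊓ betaIdeal A B = ⊥ ∧
    Finite (MonoidAlgebra ℤ A ⧸ (alphaIdeal A B ⊔ betaIdeal A B)) ∧
    Nat.card (MonoidAlgebra ℤ A ⧸ (alphaIdeal A B ⊔ betaIdeal A B)) =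
      Fintype.card B ^ (Fintype.card A / Fintype.card B) := by
  have : NeZero (Fintype.card B) := ⟨Fintype.card_ne_zero⟩
  refine ⟨alphaIdeal_inf_betaIdeal B,
    Finite.of_equiv _ (quotientAlphaSupBetaEquiv B).symm.toEquiv, ?_⟩
  rw [Nat.card_congr (quotientAlphaSupBetaEquiv B).toEquiv, Nat.card_fun, Nat.card_zmod]
  congr 1
  have h := B.card_eq_card_quotient_mul_card_subgroup
  rw [Nat.card_eq_fintype_card (α := A), Nat.card_eq_fintype_card (α := B)] at h
  rw [h, Nat.mul_div_cancel _ Fintype.card_pos]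

end
end

section
/- Let A be a finite abelian group and B₁,…,B_k ⊆ A subgroups. In ℤ[A], let β(B_j) be the ideal generated by {1 − b : b ∈ B_j} and α(B_j) the ideal generated by Σ_{b∈B_j} b, and set α := α(B₁) + ⋯ + α(B_k) and β := β(B₁) ∩ ⋯ ∩ β(B_k). Then the quotient group ℤ[A]/(α + β) is finite with |ℤ[A]/(α + β)| ≤ ∏_{j=1}^k |B_j|^{|A|/|B_j|}. -/
noncomputable section

open Matrix

theorem Matrix.PosSemidef.det_le_one_of_diag_eq_one {n : Type*} [Fintype n] [DecidableEq n]
    {M : Matrix n n ℝ} (hM : M.PosSemidef) (hd : ∀ i, M i i = 1) : M.det ≤ 1 := by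
  have htr : ∑ i, (hM.isHermitian.eigenvalues i - 1) = 0 := by
    have h := hM.isHermitian.trace_eq_sum_eigenvalues
    simp only [Matrix.trace, Matrix.diag_apply, hd, RCLike.ofReal_real_eq_id, id_eq] at h
    rw [Finset.sum_sub_distrib, ← h, sub_self]
  calc M.det = ∏ i, hM.isHermitian.eigenvalues i := by
        simpa using hM.isHermitian.det_eq_prod_eigenvalues
    _ ≤ ∏ i, Real.exp (hM.isHermitian.eigenvalues i - 1) :=
        Finset.prod_le_prod (fun i _ => hM.eigenvalues_nonneg i) fun i _ => by
          linarith [Real.add_one_le_exp (hM.isHermitian.eigenvalues i - 1)]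
    _ = 1 := by rw [← Real.exp_sum, htr, Real.exp_zero]

/-- **Hadamard's inequality** for positive semidefinite matrices with positive diagonal. -/
theorem Matrix.PosSemidef.det_le_prod_diag {n : Type*} [Fintype n] [DecidableEq n]
    {M : Matrix n n ℝ} (hM : M.PosSemidef) (hd : ∀ i, 0 < M i i) : M.det ≤ ∏ i, M i i := by
  set D : Matrix n n ℝ := diagonal fun i => (√(M i i))⁻¹ with hD
  have hN : (D * M * D).PosSemidef := by
    simpa [hD, diagonal_conjTranspose] using hM.mul_mul_conjTranspose_same D
  have h1 := hN.det_le_one_of_diag_eq_one fun i => by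
    have h := Real.mul_self_sqrt (hd i).le
    have h0 := (Real.sqrt_pos.2 (hd i)).ne'
    simp only [hD, diagonal_mul, mul_diagonal]
    field_simp
    linarith
  have hdet : (D * M * D).det = M.det / ∏ i, M i i := by
    rw [det_mul, det_mul, hD, det_diagonal, mul_right_comm, ← Finset.prod_mul_distrib,
      div_eq_inv_mul, ← Finset.prod_inv_distrib]
    congr 1
    refine Finset.prod_congr rfl fun i _ => ?_
    rw [← mul_inv, Real.mul_self_sqrt (hd i).le]
  rwa [hdet, div_le_one (Finset.prod_pos fun i _ => hd i)] at h1

theorem Matrix.index_range_mulVecLin {n : Type*} [Fintype n] [DecidableEq n]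
    (G : Matrix n n ℤ) (hG : G.det ≠ 0) :
    (LinearMap.range G.mulVecLin).toAddSubgroup.index = G.det.natAbs := by
  have hinj : Function.Injective G.mulVecLin := mulVec_injective_of_det_ne_zero hG
  have h := Submodule.natAbs_det_equiv (LinearMap.range G.mulVecLin)
    (LinearEquiv.ofInjective G.mulVecLin hinj)
  rw [show (LinearMap.range G.mulVecLin).toAddSubgroup.index =
    Nat.card ((n → ℤ) ⧸ LinearMap.range G.mulVecLin) from rfl, ← h, ← LinearMap.det_toLin' G]
  rfl

theorem det_mul_transpose_ne_zero {ι X : Type*} [Fintype ι] [DecidableEq ι] [Fintype X]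
    {W : Matrix ι X ℤ} (hW : LinearIndependent ℤ W.row) : (W * Wᵀ).det ≠ 0 := by
  intro h
  obtain ⟨c, hc0, hc⟩ := exists_mulVec_eq_zero_iff.2 h
  refine hc0 (vecMul_injective_iff.2 hW ?_)
  dsimp only
  rw [zero_vecMul, ← dotProduct_self_eq_zero, ← dotProduct_mulVec, ← mulVec_transpose,
    mulVec_mulVec, hc, dotProduct_zero]

theorem det_mul_transpose_le {ι X : Type*} [Fintype ι] [DecidableEq ι] [Fintype X]
    {W : Matrix ι X ℤ} (hW : ∀ i, W i ≠ 0) : |(W * Wᵀ).det| ≤ ∏ i, W i ⬝ᵥ W i := by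
  have hps := posSemidef_self_mul_conjTranspose (W.map (Int.cast : ℤ → ℝ))
  have hmap : W.map (Int.cast : ℤ → ℝ) * (W.map (Int.cast : ℤ → ℝ))ᴴ =
      (Int.castRingHom ℝ).mapMatrix (W * Wᵀ) := by
    ext i j
    simp [mul_apply]
  rw [hmap] at hps
  have hdiag : ∀ i, (W * Wᵀ) i i = W i ⬝ᵥ W i := fun i => rfl
  have h := hps.det_le_prod_diag fun i => by
    have : 0 < W i ⬝ᵥ W i := lt_of_le_of_ne (Finset.sum_nonneg fun _ _ => mul_self_nonneg _)
      fun h => hW i (dotProduct_self_eq_zero.1 h.symm)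
    simpa [hdiag] using this
  rw [← abs_of_nonneg hps.det_nonneg, ← RingHom.map_det] at h
  simp only [RingHom.mapMatrix_apply, map_apply, hdiag, eq_intCast] at h
  exact_mod_cast h

theorem index_le_of_linearIndependent {ι X : Type*} [Fintype ι] [Fintype X]
    (v : ι → X → ℤ) (hv : LinearIndependent ℤ v) (S : AddSubgroup (X → ℤ))
    (hvS : ∀ i, v i ∈ S) (hS : ∀ x, (∀ i, v i ⬝ᵥ x = 0) → x ∈ S) :
    S.index ≠ 0 ∧ (S.index : ℤ) ≤ ∏ i, v i ⬝ᵥ v i := by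
  classical
  let W : Matrix ι X ℤ := of v
  have hdet : (W * Wᵀ).det ≠ 0 := det_mul_transpose_ne_zero hv
  let H := (LinearMap.range (W * Wᵀ).mulVecLin).toAddSubgroup
  have hle : H.comap W.mulVecLin.toAddMonoidHom ≤ S := by
    rintro x ⟨c, hc⟩
    have h0 : W *ᵥ (x - Wᵀ *ᵥ c) = 0 := by
      rw [mulVec_sub, mulVec_mulVec, sub_eq_zero]
      exact hc.symm
    have h1 : x - Wᵀ *ᵥ c ∈ S := hS _ fun i => congrFun h0 i
    have h2 : Wᵀ *ᵥ c ∈ S := by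
      rw [mulVec_transpose, vecMul_eq_sum]
      exact S.sum_mem fun i _ => S.zsmul_mem (hvS i) (c i)
    simpa using S.add_mem h1 h2
  have hdvd : S.index ∣ (W * Wᵀ).det.natAbs := by
    rw [← index_range_mulVecLin _ hdet]
    refine (AddSubgroup.index_dvd_of_le hle).trans ?_
    rw [AddSubgroup.index_comap]
    exact AddSubgroup.relIndex_dvd_index_of_normal _ _
  have hpos := Int.natAbs_pos.2 hdet
  refine ⟨(Nat.pos_of_dvd_of_pos hdvd hpos).ne', ?_⟩
  calc (S.index : ℤ) ≤ (W * Wᵀ).det.natAbs := by exact_mod_cast Nat.le_of_dvd hpos hdvd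
    _ = |(W * Wᵀ).det| := Int.natCast_natAbs _
    _ ≤ _ := det_mul_transpose_le hv.ne_zero

theorem index_le_prod_dotProduct {ι X : Type*} [Fintype ι] [Fintype X]
    (v : ι → X → ℤ) (hv : ∀ i, v i ≠ 0) (S : AddSubgroup (X → ℤ))
    (hvS : ∀ i, v i ∈ S) (hS : ∀ x, (∀ i, v i ⬝ᵥ x = 0) → x ∈ S) :
    S.index ≠ 0 ∧ (S.index : ℤ) ≤ ∏ i, v i ⬝ᵥ v i := by
  classical
  have hpos : ∀ i, 0 < v i ⬝ᵥ v i := fun i =>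
    lt_of_le_of_ne (Finset.sum_nonneg fun _ _ => mul_self_nonneg _)
      fun h => hv i (dotProduct_self_eq_zero.1 h.symm)
  obtain ⟨s, hs, hmax⟩ := exists_maximal_linearIndepOn ℤ v
  obtain ⟨h0, hle⟩ := index_le_of_linearIndependent (fun i : s => v i) hs S (fun i => hvS i)
    fun x hx => hS x fun i => by
      by_cases hi : i ∈ s
      · exact hx ⟨i, hi⟩
      obtain ⟨a, ha, hmem⟩ := hmax i hi
      have hker : Submodule.span ℤ (v '' s) ≤ LinearMap.ker ((dotProductBilin ℤ ℤ).flip x) := by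
        rw [Submodule.span_le]
        rintro _ ⟨j, hj, rfl⟩
        exact hx ⟨j, hj⟩
      have h : (a • v i) ⬝ᵥ x = 0 := hker hmem
      rw [smul_dotProduct] at h
      exact (smul_eq_zero.1 h).resolve_left ha
  refine ⟨h0, hle.trans ?_⟩
  rw [Finset.prod_set_coe s (f := fun i => v i ⬝ᵥ v i), ← Finset.prod_mul_prod_compl s.toFinset]
  exact le_mul_of_one_le_right (Finset.prod_nonneg fun i _ => (hpos i).le)
    (Finset.prod_pos fun i _ => hpos i)

/-- The indicator function of the coset `q`. -/
def cosetIndicator {A : Type*} [CommGroup A] (B : Subgroup A) (q : A ⧸ B) : A → ℤ :=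
  Set.indicator {a | (a : A ⧸ B) = q} 1

theorem cosetIndicator_dotProduct {A : Type*} [CommGroup A] [Fintype A] (B : Subgroup A)
    [DecidablePred (· ∈ B)] (g : A) (x : A → ℤ) :
    cosetIndicator B g ⬝ᵥ x = ∑ b : B, x (g * b) := by
  classical
  simp only [cosetIndicator, dotProduct, Set.indicator_apply, Set.mem_ofPred_eq, Pi.one_apply,
    ite_mul, one_mul, zero_mul]
  rw [← Finset.sum_filter]
  symm
  refine Finset.sum_bij (fun b _ => g * b) ?_ ?_ ?_ fun _ _ => rfl
  · intro b _
    simp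
  · intro b _ c _ h
    exact Subtype.ext (mul_left_cancel h)
  · intro a ha
    refine ⟨⟨g⁻¹ * a, QuotientGroup.eq.1 ?_⟩, Finset.mem_univ _, ?_⟩
    · exact (Finset.mem_filter.1 ha).2.symm
    · simp

theorem sum_of_mul_single_coeff {A : Type} [CommGroup A] [Fintype A] (B : Subgroup A)
    [DecidablePred (· ∈ B)] (g : A) :
    ⇑((∑ b : B, MonoidAlgebra.of ℤ A (b : A)) * MonoidAlgebra.of ℤ A g).coeff =
      cosetIndicator B g := by
  classical
  ext a
  have h := cosetIndicator_dotProduct B g (Pi.single a 1)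
  rw [dotProduct_single, mul_one] at h
  rw [h, Finset.sum_mul]
  simp only [MonoidAlgebra.of_apply]
  simp [Finsupp.single_apply, Pi.single_apply, eq_comm, mul_comm]

theorem mem_betaIdeal_of_cosetIndicator_dotProduct_eq_zero {A : Type} [CommGroup A] [Fintype A]
    (B : Subgroup A) (x : MonoidAlgebra ℤ A)
    (hx : ∀ q : A ⧸ B, cosetIndicator B q ⬝ᵥ ⇑x.coeff = 0) : x ∈ betaIdeal A B := by
  classical
  let F : A ⧸ B → MonoidAlgebra ℤ A ⧸ betaIdeal A B := fun q =>
    Ideal.Quotient.mk _ (MonoidAlgebra.of ℤ A q.out)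
  have hF (a : A) : Ideal.Quotient.mk (betaIdeal A B) (MonoidAlgebra.of ℤ A a) = F a := by
    have hmem : a⁻¹ * (a : A ⧸ B).out ∈ B :=
      QuotientGroup.eq.1 (QuotientGroup.out_eq' (a : A ⧸ B)).symm
    rw [Ideal.Quotient.eq]
    have h : MonoidAlgebra.of ℤ A a - MonoidAlgebra.of ℤ A (a : A ⧸ B).out =
        MonoidAlgebra.of ℤ A a * (1 - MonoidAlgebra.of ℤ A (a⁻¹ * (a : A ⧸ B).out)) := by
      rw [mul_sub, mul_one, ← map_mul, mul_inv_cancel_left]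
    rw [h]
    exact Ideal.mul_mem_left _ _ (Ideal.subset_span ⟨_, hmem, rfl⟩)
  have hsum : x = ∑ a, x.coeff a • MonoidAlgebra.of ℤ A a := by
    ext a
    simp [MonoidAlgebra.coeff_sum]
  rw [← Ideal.Quotient.eq_zero_iff_mem, hsum, map_sum]
  simp only [map_zsmul, hF]
  rw [← Finset.sum_fiberwise Finset.univ (fun a : A => (a : A ⧸ B))]
  refine Finset.sum_eq_zero fun q _ => ?_
  have hq : ∑ a ∈ Finset.univ.filter fun a : A => (a : A ⧸ B) = q, x.coeff a = 0 := by
    rw [← hx q, Finset.sum_filter]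
    simp [cosetIndicator, dotProduct, Set.indicator_apply]
  calc _ = ∑ a ∈ Finset.univ.filter fun a : A => (a : A ⧸ B) = q, x.coeff a • F q :=
        Finset.sum_congr rfl fun a ha => by rw [(Finset.mem_filter.1 ha).2]
    _ = 0 := by rw [← Finset.sum_smul, hq, zero_smul]

theorem cosetIndicator_dotProduct_self {A : Type*} [CommGroup A] [Fintype A] (B : Subgroup A)
    [DecidablePred (· ∈ B)] (q : A ⧸ B) :
    cosetIndicator B q ⬝ᵥ cosetIndicator B q = Fintype.card B := by
  obtain ⟨g, rfl⟩ := QuotientGroup.mk_surjective q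
  rw [cosetIndicator_dotProduct]
  simp [cosetIndicator]

theorem statement10 (A : Type) [CommGroup A] [Fintype A] (k : ℕ) (B : Fin k → Subgroup A)
    [∀ j, DecidablePred (· ∈ B j)] :
    Finite (MonoidAlgebra ℤ A ⧸ ((⨆ j, alphaIdeal A (B j)) ⊔ (⨅ j, betaIdeal A (B j)))) ∧
    Nat.card (MonoidAlgebra ℤ A ⧸ ((⨆ j, alphaIdeal A (B j)) ⊔ (⨅ j, betaIdeal A (B j))))
      ≤ ∏ j, Fintype.card (B j) ^ (Fintype.card A / Fintype.card (B j)) := by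
  classical
  set I := (⨆ j, alphaIdeal A (B j)) ⊔ (⨅ j, betaIdeal A (B j)) with hI
  let e : MonoidAlgebra ℤ A ≃+ (A → ℤ) :=
    MonoidAlgebra.coeffAddEquiv.trans (Finsupp.linearEquivFunOnFinite ℤ ℤ A).toAddEquiv
  let S : AddSubgroup (A → ℤ) := I.toAddSubgroup.comap e.symm.toAddMonoidHom
  let v : (Σ j, A ⧸ B j) → A → ℤ := fun p => cosetIndicator (B p.1) p.2
  have hvv (p) : v p ⬝ᵥ v p = Fintype.card (B p.1) := cosetIndicator_dotProduct_self _ _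
  obtain ⟨h0, hle⟩ := index_le_prod_dotProduct v
    (fun p hp => by
      have h := hvv p
      rw [hp, dotProduct_zero] at h
      exact Fintype.card_ne_zero (Nat.cast_eq_zero.1 h.symm))
    S
    (fun ⟨j, q⟩ => by
      obtain ⟨g, rfl⟩ := QuotientGroup.mk_surjective q
      have h : e ((∑ b : B j, MonoidAlgebra.of ℤ A (b : A)) * MonoidAlgebra.of ℤ A g) =
          v ⟨j, g⟩ := sum_of_mul_single_coeff (B j) g
      change e.symm (v ⟨j, g⟩) ∈ I
      rw [← h, e.symm_apply_apply]
      refine Ideal.mem_sup_left (le_iSup (fun j => alphaIdeal A (B j)) j ?_)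
      exact Ideal.mul_mem_right _ _ (Ideal.subset_span rfl))
    (fun x hx => by
      change e.symm x ∈ I
      refine Ideal.mem_sup_right ((Submodule.mem_iInf _).2 fun j => ?_)
      refine mem_betaIdeal_of_cosetIndicator_dotProduct_eq_zero _ _ fun q => ?_
      have h : ⇑(e.symm x).coeff = x := e.apply_symm_apply x
      rw [h]
      exact hx ⟨j, q⟩)
  have hindex : S.index = Nat.card (MonoidAlgebra ℤ A ⧸ I) :=
    I.toAddSubgroup.index_comap_of_surjective e.symm.surjective
  rw [hindex] at h0 hle
  refine ⟨Nat.finite_of_card_ne_zero h0, ?_⟩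
  have hcard (j) : Fintype.card (A ⧸ B j) = Fintype.card A / Fintype.card (B j) := by
    simp only [← Nat.card_eq_fintype_card]
    rw [Subgroup.card_eq_card_quotient_mul_card_subgroup (B j),
      Nat.mul_div_cancel _ Nat.card_pos]
  have hprod : ∏ p, v p ⬝ᵥ v p =
      ∏ j, (Fintype.card (B j) : ℤ) ^ (Fintype.card A / Fintype.card (B j)) := by
    rw [Fintype.prod_sigma]
    refine Finset.prod_congr rfl fun j _ => ?_
    rw [← hcard, ← Finset.card_univ (α := A ⧸ B j)]
    exact Finset.prod_eq_pow_card fun q _ => hvv ⟨j, q⟩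
  rw [hprod] at hle
  exact_mod_cast hle

end
end

section
/- Let X ⊆ ℂⁿ be an algebraic subset defined over ℚ (the common zero set of a family of polynomials with rational coefficients) with X ≠ ℂⁿ. Then there exist finitely many nonzero subgroups Λ₁,…,Λ_k of ℤⁿ such that every torsion point of (ℂ*)ⁿ lying in X belongs to G(Λ₁) ∪ ⋯ ∪ G(Λ_k). -/
open Polynomial in
theorem Polynomial.nextCoeff_cyclotomic {d : ℕ} (hd : 0 < d) :
    (cyclotomic d ℚ).nextCoeff = -(ArithmeticFunction.moebius d : ℚ) := by
  have hsum : ∀ n > 0, ∑ i ∈ n.divisors, (cyclotomic i ℚ).nextCoeff =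
      if n = 1 then (-1 : ℚ) else 0 := by
    intro n hn
    rw [← Monic.nextCoeff_prod _ _ fun i _ => cyclotomic.monic i ℚ,
      prod_cyclotomic_eq_X_pow_sub_one hn, ← C_1, nextCoeff_of_natDegree_pos
        (by rwa [natDegree_X_pow_sub_C]), natDegree_X_pow_sub_C, coeff_sub, coeff_X_pow, coeff_C]
    grind
  rw [← ArithmeticFunction.sum_eq_iff_sum_mul_moebius_eq.1 hsum d hd,
    Finset.sum_eq_single (d, 1)]
  · simp
  · rintro ⟨a, b⟩ hab hne
    rw [Nat.mem_divisorsAntidiagonal] at hab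
    have hb : b ≠ 1 := by
      rintro rfl
      exact hne (by simp [← hab.1])
    simp [hb]
  · intro h
    simp [Nat.mem_divisorsAntidiagonal, hd.ne'] at h

theorem Nat.dvd_factorial_of_totient_le {d B : ℕ} (hd : 0 < d) (h : d.totient ≤ B) :
    d ∣ (2 * B).factorial := by
  rw [Nat.dvd_iff_prime_pow_dvd_dvd]
  intro p k hp hpk
  refine Nat.dvd_factorial (pow_pos hp.pos k) ?_
  have hle : (p ^ k).totient ≤ B :=
    (Nat.le_of_dvd (Nat.totient_pos.2 hd) (Nat.totient_dvd_of_dvd hpk)).trans h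
  rcases k with _ | k
  · have := Nat.totient_pos.2 hd
    rw [pow_zero]
    lia
  · rw [Nat.totient_prime_pow_succ hp] at hle
    have hp2 : p ≤ 2 * (p - 1) := by have := hp.two_le; lia
    calc p ^ (k + 1) = p ^ k * p := pow_succ p k
      _ ≤ p ^ k * (2 * (p - 1)) := Nat.mul_le_mul_left _ hp2
      _ = 2 * (p ^ k * (p - 1)) := by ring
      _ ≤ 2 * B := Nat.mul_le_mul_left _ hle

theorem abs_normalizedTrace_le_inv_totient_orderOf {K : Type*} [Field K] [CharZero K]
    [Algebra.IsIntegral ℚ K] {w : K} (hw : IsOfFinOrder w) :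
    |Algebra.normalizedTrace ℚ K w| ≤ ((orderOf w).totient : ℚ)⁻¹ := by
  have hd : 0 < orderOf w := hw.orderOf_pos
  rw [Algebra.normalizedTrace_minpoly,
    ← Polynomial.cyclotomic_eq_minpoly_rat (IsPrimitiveRoot.orderOf w) hd,
    Polynomial.natDegree_cyclotomic, Polynomial.nextCoeff_cyclotomic hd, neg_neg, smul_eq_mul,
    abs_mul, abs_of_nonneg (by positivity)]
  refine mul_le_of_le_one_right (by positivity) ?_
  exact_mod_cast ArithmeticFunction.abs_moebius_le_one

/-- In a vanishing rational linear combination of roots of unity, some ratio of two of the terms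
has order bounded in terms of the coefficients only. -/
theorem exists_div_pow_factorial_eq_one {ι K : Type*} [Field K] [CharZero K]
    [Algebra.IsIntegral ℚ K] (s : Finset ι) (c : ι → ℚ) {B : ℕ} (hc : ∃ i ∈ s, c i ≠ 0)
    (hB : (∑ i ∈ s, |c i|) ^ 2 ≤ B * ∑ i ∈ s, c i ^ 2) (m : ι → K)
    (hm : ∀ i ∈ s, IsOfFinOrder (m i)) (h : ∑ i ∈ s, c i • m i = 0)
    (h_inv : ∑ i ∈ s, c i • (m i)⁻¹ = 0) :
    ∃ i ∈ s, ∃ j ∈ s, i ≠ j ∧ (m i / m j) ^ (2 * B).factorial = 1 := by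
  classical
  by_contra! hne
  have hpos : 0 < ∑ i ∈ s, c i ^ 2 := by
    obtain ⟨i, hi, hci⟩ := hc
    exact Finset.sum_pos' (fun _ _ => sq_nonneg _) ⟨i, hi, by positivity⟩
  have hfin : ∀ i ∈ s, ∀ j ∈ s, IsOfFinOrder (m i / m j) := by
    intro i hi j hj
    obtain ⟨a, ha, hai⟩ := isOfFinOrder_iff_pow_eq_one.1 (hm i hi)
    obtain ⟨b, hb, hbj⟩ := isOfFinOrder_iff_pow_eq_one.1 (hm j hj)
    refine isOfFinOrder_iff_pow_eq_one.2 ⟨a * b, by positivity, ?_⟩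
    rw [div_pow, pow_mul, hai, mul_comm, pow_mul, hbj]
    simp
  have hm0 : ∀ i ∈ s, m i ≠ 0 := by
    intro i hi h0
    obtain ⟨a, ha, hai⟩ := isOfFinOrder_iff_pow_eq_one.1 (hm i hi)
    rw [h0, zero_pow ha.ne'] at hai
    exact zero_ne_one hai
  let t : K →ₗ[ℚ] ℚ := Algebra.normalizedTrace ℚ K
  have hsum : ∑ i ∈ s, ∑ j ∈ s, c i * c j * t (m i / m j) = 0 := by
    have h1 : ∑ i ∈ s, ∑ j ∈ s, (c i * c j) • (m i / m j) = 0 := by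
      have := congrArg₂ (· * ·) h h_inv
      simp only [Finset.sum_mul_sum, mul_zero] at this
      rw [← this]
      refine Finset.sum_congr rfl fun i _ => Finset.sum_congr rfl fun j _ => ?_
      rw [smul_mul_smul_comm, div_eq_mul_inv]
    simpa [map_sum] using congrArg (Algebra.normalizedTrace ℚ K) h1
  have ht1 : t 1 = 1 := by
    have := Algebra.normalizedTrace_minpoly ℚ (1 : K)
    rw [minpoly.one, ← Polynomial.C_1, Polynomial.natDegree_X_sub_C,
      Polynomial.nextCoeff_X_sub_C] at this
    simpa using this
  have hterm : ∀ i ∈ s, ∀ j ∈ s, (B + 1) * (c i * c j * t (m i / m j)) ≥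
      (if i = j then (B + 1) * c i ^ 2 + |c i| * |c j| else 0) - |c i| * |c j| := by
    intro i hi j hj
    split_ifs with hij
    · subst hij
      rw [div_self (hm0 i hi), ht1]
      exact le_of_eq (by ring)
    · have hd := (hfin i hi j hj).orderOf_pos
      have hlt : B + 1 ≤ (orderOf (m i / m j)).totient := by
        by_contra! hlt
        exact hne i hi j hj hij (orderOf_dvd_iff_pow_eq_one.1
          (Nat.dvd_factorial_of_totient_le hd (by lia)))
      have hle : (B + 1) * |t (m i / m j)| ≤ 1 := by
        have h1 := abs_normalizedTrace_le_inv_totient_orderOf (hfin i hi j hj)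
        have h2 : (((orderOf (m i / m j)).totient : ℚ))⁻¹ ≤ ((B : ℚ) + 1)⁻¹ :=
          inv_anti₀ (by positivity) (by exact_mod_cast hlt)
        calc ((B : ℚ) + 1) * |t (m i / m j)| ≤ (B + 1) * ((B : ℚ) + 1)⁻¹ := by
              gcongr
              exact h1.trans h2
          _ = 1 := mul_inv_cancel₀ (by positivity)
      have habs : |(B + 1) * (c i * c j * t (m i / m j))| ≤ |c i| * |c j| := by
        rw [abs_mul, abs_mul, abs_mul, abs_of_nonneg (show (0 : ℚ) ≤ B + 1 by positivity)]
        calc ((B : ℚ) + 1) * (|c i| * |c j| * |t (m i / m j)|)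
            = |c i| * |c j| * ((B + 1) * |t (m i / m j)|) := by ring
          _ ≤ |c i| * |c j| := mul_le_of_le_one_right (by positivity) hle
      linarith [(abs_le.1 habs).1]
  have hle := Finset.sum_le_sum fun i hi => Finset.sum_le_sum fun j hj => hterm i hi j hj
  have hdiag : ∑ i ∈ s, |c i| * |c i| = ∑ i ∈ s, c i ^ 2 :=
    Finset.sum_congr rfl fun i _ => by rw [abs_mul_abs_self, sq]
  have hprod : ∑ i ∈ s, ∑ j ∈ s, |c i| * |c j| = (∑ i ∈ s, |c i|) ^ 2 := by
    rw [sq, Finset.sum_mul_sum]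
  simp only [← Finset.mul_sum, hsum, Finset.sum_sub_distrib, Finset.sum_ite_eq] at hle
  simp only [Finset.mul_sum, hprod] at hle
  rw [Finset.sum_ite_mem, Finset.inter_self, Finset.sum_add_distrib, hdiag,
    ← Finset.mul_sum] at hle
  linarith

theorem Complex.inv_eq_conj_of_isOfFinOrder {w : ℂ} (hw : IsOfFinOrder w) :
    w⁻¹ = starRingEnd ℂ w := by
  have hn : ‖w‖ = 1 := by
    obtain ⟨a, ha, hwa⟩ := isOfFinOrder_iff_pow_eq_one.1 hw
    exact Complex.norm_eq_one_of_pow_eq_one hwa ha.ne'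
  rw [Complex.inv_eq_conj hn]

/-- The complex form of `exists_div_pow_factorial_eq_one`, where the inverse combination vanishes
by complex conjugation. -/
theorem Complex.exists_div_pow_factorial_eq_one {ι : Type*} (s : Finset ι) (c : ι → ℚ) {B : ℕ}
    (hc : ∃ i ∈ s, c i ≠ 0) (hB : (∑ i ∈ s, |c i|) ^ 2 ≤ B * ∑ i ∈ s, c i ^ 2) (m : ι → ℂ)
    (hm : ∀ i, IsOfFinOrder (m i)) (h : ∑ i ∈ s, c i • m i = 0) :
    ∃ i ∈ s, ∃ j ∈ s, i ≠ j ∧ (m i / m j) ^ (2 * B).factorial = 1 := by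
  have hconj : ∑ i ∈ s, c i • (m i)⁻¹ = 0 := by
    have := congrArg (starRingEnd ℂ) h
    simpa [Complex.inv_eq_conj_of_isOfFinOrder (hm _), Algebra.smul_def] using this
  have hmem : ∀ i, m i ∈ algebraicClosure ℚ ℂ := by
    intro i
    obtain ⟨a, ha, hia⟩ := isOfFinOrder_iff_pow_eq_one.1 (hm i)
    have : IsIntegral ℚ (m i) := IsIntegral.of_pow ha (hia ▸ isIntegral_one)
    exact mem_algebraicClosure_iff.2 this.isAlgebraic
  have : Algebra.IsIntegral ℚ (algebraicClosure ℚ ℂ) :=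
    Algebra.isAlgebraic_iff_isIntegral.1 (algebraicClosure.isAlgebraic ℚ ℂ)
  lift m to ι → algebraicClosure ℚ ℂ using hmem
  have hm' : ∀ i ∈ s, IsOfFinOrder (m i) := by
    intro i _
    obtain ⟨a, ha, hia⟩ := isOfFinOrder_iff_pow_eq_one.1 (hm i)
    exact isOfFinOrder_iff_pow_eq_one.2 ⟨a, ha, Subtype.ext (by simpa using hia)⟩
  obtain ⟨i, hi, j, hj, hij, hpow⟩ := _root_.exists_div_pow_factorial_eq_one s c hc hB m hm'
    (Subtype.ext (by simpa using h)) (Subtype.ext (by simpa using hconj))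
  exact ⟨i, hi, j, hj, hij, by simpa using congrArg (Subtype.val) hpow⟩

/-- Any torsion point of `(ℂ*)ⁿ` lying in a proper algebraic subset of `ℂⁿ` defined over `ℚ`
lies in one of finitely many proper algebraic subgroups `G(Λ₁), …, G(Λ_k)`. -/
theorem statement11 {n : ℕ} (S : Set (MvPolynomial (Fin n) ℚ)) (X : Set (Fin n → ℂ))
    (hX : X = {z | ∀ p ∈ S, MvPolynomial.eval₂ (algebraMap ℚ ℂ) z p = 0})
    (hXne : X ≠ Set.univ) :
    ∃ (k : ℕ) (Λ : Fin k → AddSubgroup (Fin n → ℤ)), (∀ j, Λ j ≠ ⊥) ∧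
      ∀ z : Fin n → ℂ, (∀ i, ∃ m : ℕ, 0 < m ∧ z i ^ m = 1) → z ∈ X →
        ∃ j, ∀ κ ∈ Λ j, ∏ i, z i ^ (κ i) = 1 := by
  classical
  obtain ⟨p, hpS, hp0⟩ : ∃ p ∈ S, p ≠ 0 := by
    by_contra! hS
    refine hXne (hX.trans (Set.eq_univ_of_forall fun z p hp => ?_))
    rw [hS p hp, MvPolynomial.eval₂_zero]
  have hc : ∃ α ∈ p.support, p.coeff α ≠ 0 := by
    obtain ⟨α, hα⟩ := MvPolynomial.ne_zero_iff.1 hp0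
    exact ⟨α, MvPolynomial.mem_support_iff.2 hα, hα⟩
  obtain ⟨B, hB⟩ : ∃ B : ℕ, (∑ α ∈ p.support, |p.coeff α|) ^ 2 ≤
      B * ∑ α ∈ p.support, p.coeff α ^ 2 := by
    have hpos : 0 < ∑ α ∈ p.support, p.coeff α ^ 2 := by
      obtain ⟨α, hα, hα0⟩ := hc
      exact Finset.sum_pos' (fun _ _ => sq_nonneg _) ⟨α, hα, by positivity⟩
    obtain ⟨B, hB⟩ := exists_nat_ge
      ((∑ α ∈ p.support, |p.coeff α|) ^ 2 / ∑ α ∈ p.support, p.coeff α ^ 2)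
    exact ⟨B, (div_le_iff₀ hpos).1 hB⟩
  set M := (2 * B).factorial with hM
  let v : (Fin n →₀ ℕ) × (Fin n →₀ ℕ) → Fin n → ℤ := fun q i => M * ((q.1 i : ℤ) - q.2 i)
  let e := p.support.offDiag.equivFin
  refine ⟨_, fun j => AddSubgroup.zmultiples (v (e.symm j)), fun j h => ?_, fun z hz hzX => ?_⟩
  · have hne := (Finset.mem_offDiag.1 (e.symm j).2).2.2
    rw [AddSubgroup.zmultiples_eq_bot] at h
    refine hne (Finsupp.ext fun i => ?_)
    have hi := congrFun h i
    simpa [v, hM, Nat.factorial_ne_zero, sub_eq_zero] using hi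
  · have hz0 : ∀ i, z i ≠ 0 := by
      intro i h0
      obtain ⟨m, hm, hzm⟩ := hz i
      rw [h0, zero_pow hm.ne'] at hzm
      exact zero_ne_one hzm
    have heval : ∑ α ∈ p.support, p.coeff α • ∏ i, z i ^ α i = 0 := by
      rw [hX] at hzX
      have := hzX p hpS
      rw [MvPolynomial.eval₂_eq'] at this
      simpa only [Algebra.smul_def] using this
    obtain ⟨α, hα, β, hβ, hαβ, hpow⟩ := Complex.exists_div_pow_factorial_eq_one p.support
      (fun α => p.coeff α) hc hB (fun α => ∏ i, z i ^ α i)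
      (fun α => Submonoid.prod_mem (CommMonoid.torsion ℂ) fun i _ =>
        pow_mem (isOfFinOrder_iff_pow_eq_one.2 (hz i)) _) heval
    refine ⟨e ⟨(α, β), Finset.mem_offDiag.2 ⟨hα, hβ, hαβ⟩⟩, fun κ hκ => ?_⟩
    obtain ⟨a, rfl⟩ := AddSubgroup.mem_zmultiples_iff.1 hκ
    have hv : ∏ i, z i ^ v (α, β) i = 1 := by
      rw [← hpow, ← Finset.prod_div_distrib, ← Finset.prod_pow]
      refine Finset.prod_congr rfl fun i _ => ?_
      rw [← zpow_natCast, ← zpow_natCast, ← zpow_natCast, ← zpow_sub₀ (hz0 i), ← zpow_mul,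
        mul_comm]
    simp only [Equiv.symm_apply_apply, Pi.smul_apply, smul_eq_mul]
    simp_rw [mul_comm a, zpow_mul, Finset.prod_zpow, hv, one_zpow]
end

section
/- Suppose that for every finite-index subgroup Γ ⊆ ℤⁿ one is given abelian groups N₁(Γ), M₁(Γ), M₂(Γ), N₂(Γ) and a sequence of homomorphisms N₁(Γ) → M₁(Γ) → M₂(Γ) → N₂(Γ) which is exact at M₁(Γ) and at M₂(Γ), such that N₁(Γ) and N₂(Γ) are finite, the torsion subgroups Tor_ℤ(M₁(Γ)) and Tor_ℤ(M₂(Γ)) are finite, and log|N_i(Γ)| / [ℤⁿ:Γ] → 0 as ⟨Γ⟩ → ∞ for i = 1, 2. Then (log|Tor_ℤ(M₁(Γ))| − log|Tor_ℤ(M₂(Γ))|) / [ℤⁿ:Γ] → 0 as ⟨Γ⟩ → ∞. -/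
open Filter

noncomputable section

/-- ⟨Γ⟩ : the minimal Euclidean norm of a nonzero element of Γ. -/
def gaugeSub (n : ℕ) (Γ : AddSubgroup (Fin n → ℤ)) : ℝ :=
  sInf {r : ℝ | ∃ x ∈ Γ, x ≠ 0 ∧ r = Real.sqrt (∑ i, ((x i : ℝ)) ^ 2)}

/-- the filter of finite-index subgroups Γ ⊆ ℤⁿ with ⟨Γ⟩ → ∞. -/
def toInfty (n : ℕ) : Filter (AddSubgroup (Fin n → ℤ)) :=
  ⨅ C : ℝ, Filter.principal {Γ | Γ.FiniteIndex ∧ C < gaugeSub n Γ}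

theorem AddMonoidHom.card_eq_card_ker_mul_card_range {A B : Type*} [AddCommGroup A]
    [AddCommGroup B] (φ : A →+ B) : Nat.card A = Nat.card φ.ker * Nat.card φ.range := by
  rw [← AddSubgroup.index_ker, AddSubgroup.card_mul_index]

/-- If `N → M → M'` is exact with `N` finite, then `|Tor M| ≤ |N| * |Tor M'|`. -/
theorem Function.Exact.card_torsion_le {N M M' : Type*} [AddCommGroup N] [AddCommGroup M]
    [AddCommGroup M'] {f : N →+ M} {g : M →+ M'} (hfg : Function.Exact f g) [Finite N]
    [Finite (AddCommGroup.torsion M')] :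
    Nat.card (AddCommGroup.torsion M) ≤ Nat.card N * Nat.card (AddCommGroup.torsion M') := by
  let φ := g.comp (AddCommGroup.torsion M).subtype
  rw [φ.card_eq_card_ker_mul_card_range]
  refine Nat.mul_le_mul ?_ ?_
  · have hker (x : φ.ker) : ∃ y, f y = (x : AddCommGroup.torsion M) := (hfg _).1 x.2
    choose s hs using hker
    refine Nat.card_le_card_of_injective s fun x y hxy => ?_
    exact Subtype.ext (Subtype.ext (by rw [← hs x, ← hs y, hxy]))
  · refine Nat.card_le_card_of_injective (AddSubgroup.inclusion ?_)
      (AddSubgroup.inclusion_injective _)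
    rintro _ ⟨x, rfl⟩
    exact AddMonoidHom.isOfFinAddOrder g x.2

/-- If `N → M → M' → N'` is exact with `N` and `N'` finite, then `|Tor M'| ≤ |Tor M| * |N'|`. -/
theorem Function.Exact.card_torsion_le_mul_card {N M M' N' : Type*} [AddCommGroup N]
    [AddCommGroup M] [AddCommGroup M'] [AddCommGroup N'] {f : N →+ M} {g : M →+ M'}
    {h : M' →+ N'} (hfg : Function.Exact f g) (hgh : Function.Exact g h) [Finite N] [Finite N']
    [Finite (AddCommGroup.torsion M)] :
    Nat.card (AddCommGroup.torsion M') ≤ Nat.card (AddCommGroup.torsion M) * Nat.card N' := by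
  let φ := h.comp (AddCommGroup.torsion M').subtype
  rw [φ.card_eq_card_ker_mul_card_range]
  refine Nat.mul_le_mul ?_ (Nat.card_le_card_of_injective _ Subtype.val_injective)
  have hker (y : φ.ker) : ∃ x : AddCommGroup.torsion M, g x = (y : AddCommGroup.torsion M') := by
    obtain ⟨x, hx⟩ := (hgh _).1 y.2
    refine ⟨⟨x, ?_⟩, hx⟩
    obtain ⟨k, hk, hky⟩ := isOfFinAddOrder_iff_nsmul_eq_zero.1 y.1.2
    have hgk : g (k • x) = 0 := by rw [map_nsmul, hx]; exact hky
    obtain ⟨z, hz⟩ := (hfg _).1 hgk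
    have hkx : IsOfFinAddOrder (k • x) := hz ▸ f.isOfFinAddOrder (isOfFinAddOrder_of_finite z)
    exact hkx.of_nsmul hk.ne'
  choose s hs using hker
  refine Nat.card_le_card_of_injective s fun x y hxy => ?_
  exact Subtype.ext (Subtype.ext (by rw [← hs x, ← hs y, hxy]))

theorem eventually_finiteIndex_toInfty (n : ℕ) : ∀ᶠ Γ in toInfty n, Γ.FiniteIndex :=
  mem_iInf_of_mem 0 fun _ hΓ => hΓ.1

theorem Real.log_natCast_le_add_of_le_mul {a b c : ℕ} (ha : a ≠ 0) (hb : b ≠ 0) (hc : c ≠ 0)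
    (h : a ≤ b * c) : Real.log a ≤ Real.log b + Real.log c := by
  rw [← Real.log_mul (by exact_mod_cast hb) (by exact_mod_cast hc)]
  exact Real.log_le_log (by positivity) (by exact_mod_cast h)

theorem statement13 {n : ℕ} (hn : 1 ≤ n)
    (N₁ M₁ M₂ N₂ : AddSubgroup (Fin n → ℤ) → Type)
    [∀ Γ, AddCommGroup (N₁ Γ)] [∀ Γ, AddCommGroup (M₁ Γ)]
    [∀ Γ, AddCommGroup (M₂ Γ)] [∀ Γ, AddCommGroup (N₂ Γ)]
    (f : ∀ Γ, N₁ Γ →+ M₁ Γ) (g : ∀ Γ, M₁ Γ →+ M₂ Γ) (h : ∀ Γ, M₂ Γ →+ N₂ Γ)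
    (hex1 : ∀ Γ : AddSubgroup (Fin n → ℤ), Γ.FiniteIndex → Function.Exact (f Γ) (g Γ))
    (hex2 : ∀ Γ : AddSubgroup (Fin n → ℤ), Γ.FiniteIndex → Function.Exact (g Γ) (h Γ))
    (hfin1 : ∀ Γ : AddSubgroup (Fin n → ℤ), Γ.FiniteIndex → Finite (N₁ Γ))
    (hfin2 : ∀ Γ : AddSubgroup (Fin n → ℤ), Γ.FiniteIndex → Finite (N₂ Γ))
    (htor1 : ∀ Γ : AddSubgroup (Fin n → ℤ), Γ.FiniteIndex →
      Finite (AddCommGroup.torsion (M₁ Γ)))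
    (htor2 : ∀ Γ : AddSubgroup (Fin n → ℤ), Γ.FiniteIndex →
      Finite (AddCommGroup.torsion (M₂ Γ)))
    (hN1 : Tendsto (fun Γ => Real.log (Nat.card (N₁ Γ)) / (Γ.index : ℝ)) (toInfty n) (nhds 0))
    (hN2 : Tendsto (fun Γ => Real.log (Nat.card (N₂ Γ)) / (Γ.index : ℝ)) (toInfty n) (nhds 0)) :
    Tendsto (fun Γ => (Real.log (Nat.card (AddCommGroup.torsion (M₁ Γ)))
        - Real.log (Nat.card (AddCommGroup.torsion (M₂ Γ)))) / (Γ.index : ℝ))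
      (toInfty n) (nhds 0) := by
  have hN2' := hN2.neg
  rw [neg_zero] at hN2'
  refine tendsto_of_tendsto_of_tendsto_of_le_of_le' hN2' hN1 ?_ ?_ <;>
  filter_upwards [eventually_finiteIndex_toInfty n] with Γ hΓ <;>
  have := hfin1 Γ hΓ <;>
  have := hfin2 Γ hΓ <;>
  have := htor1 Γ hΓ <;>
  have := htor2 Γ hΓ
  · rw [← neg_div]
    gcongr
    linarith [Real.log_natCast_le_add_of_le_mul Nat.card_pos.ne' Nat.card_pos.ne' Nat.card_pos.ne'
      ((hex1 Γ hΓ).card_torsion_le_mul_card (hex2 Γ hΓ))]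
  · gcongr
    linarith [Real.log_natCast_le_add_of_le_mul Nat.card_pos.ne' Nat.card_pos.ne' Nat.card_pos.ne'
      (hex1 Γ hΓ).card_torsion_le]

end
end

section
/- Let 𝔅 be a free abelian group of finite rank, and let p, q : 𝔅 → 𝔅 be commuting ℤ-linear endomorphisms with p injective. Let C be the chain complex 0 → 𝔅 →∂₂ 𝔅 ⊕ 𝔅 →∂₁ 𝔅 → 0 where ∂₂(a) = (−q(a), p(a)) and ∂₁(a, b) = p(a) + q(b) (this is a complex since p and q commute). Then the homology groups H₁(C) = ker ∂₁ / im ∂₂ and H₀(C) = 𝔅 / im ∂₁ are finite, and |H₁(C)| = |H₀(C)|. -/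
/-- For an endomorphism `q` of an additive commutative group preserving a subgroup `P` of finite
index, the index of `P` in `q ⁻¹ P` equals the index of `P + im q`. -/
theorem AddSubgroup.relIndex_comap_eq_index_sup_range {G : Type*} [AddCommGroup G]
    (P : AddSubgroup G) (q : G →+ G) (hP : P.index ≠ 0) (hq : P ≤ P.comap q) :
    P.relIndex (P.comap q) = (P ⊔ q.range).index := by
  have h₁ : P.relIndex (P.comap q) * (P.comap q).index = P.index :=
    AddSubgroup.relIndex_mul_index hq
  have h₂ : P.relIndex (P ⊔ q.range) * (P ⊔ q.range).index = P.index :=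
    AddSubgroup.relIndex_mul_index le_sup_left
  have h₃ : (P.comap q).index = P.relIndex (P ⊔ q.range) := by
    rw [AddSubgroup.index_comap, sup_comm, AddSubgroup.relIndex_sup_right]
  have h₄ : (P.comap q).index ≠ 0 := fun h ↦ hP (by rw [← h₁, h, mul_zero])
  rw [← h₃] at h₂
  exact Nat.eq_of_mul_eq_mul_left (Nat.pos_of_ne_zero h₄) (by rw [h₂, mul_comm, h₁])

theorem statement14 (B : Type) [AddCommGroup B] [Module.Free ℤ B] [Module.Finite ℤ B]
    (p q : B →ₗ[ℤ] B) (hcomm : p ∘ₗ q = q ∘ₗ p) (hp : Function.Injective p) :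
    Finite (LinearMap.ker (p ∘ₗ LinearMap.fst ℤ B B + q ∘ₗ LinearMap.snd ℤ B B) ⧸
      Submodule.comap
        (LinearMap.ker (p ∘ₗ LinearMap.fst ℤ B B + q ∘ₗ LinearMap.snd ℤ B B)).subtype
        (LinearMap.range (LinearMap.prod (-q) p))) ∧
    Finite (B ⧸ LinearMap.range (p ∘ₗ LinearMap.fst ℤ B B + q ∘ₗ LinearMap.snd ℤ B B)) ∧
    Nat.card (LinearMap.ker (p ∘ₗ LinearMap.fst ℤ B B + q ∘ₗ LinearMap.snd ℤ B B) ⧸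
      Submodule.comap
        (LinearMap.ker (p ∘ₗ LinearMap.fst ℤ B B + q ∘ₗ LinearMap.snd ℤ B B)).subtype
        (LinearMap.range (LinearMap.prod (-q) p))) =
    Nat.card (B ⧸ LinearMap.range (p ∘ₗ LinearMap.fst ℤ B B + q ∘ₗ LinearMap.snd ℤ B B)) := by
  set d := p ∘ₗ LinearMap.fst ℤ B B + q ∘ₗ LinearMap.snd ℤ B B
  have hd_apply (x : B × B) : d x = p x.1 + q x.2 := rfl
  have hpq (x : B) : p (q x) = q (p x) := LinearMap.congr_fun hcomm x
  let P : AddSubgroup B := p.range.toAddSubgroup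
  let Q : B →+ B := q.toAddMonoidHom
  let g : d.ker →+ B := (LinearMap.snd ℤ B B ∘ₗ d.ker.subtype).toAddMonoidHom
  have hP : P.index ≠ 0 := by
    have : Finite (B ⧸ p.range) :=
      Submodule.finiteQuotientOfFreeOfRankEq _ (LinearMap.finrank_range_of_inj hp)
    have : Finite (B ⧸ P) := this
    exact AddSubgroup.index_ne_zero_of_finite
  have hPQ : P ≤ P.comap Q := by
    rintro _ ⟨x, rfl⟩
    exact ⟨q x, hpq x⟩
  have hg : g.range = P.comap Q := by
    ext b
    constructor
    · rintro ⟨⟨x, hx⟩, rfl⟩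
      refine ⟨-x.1, ?_⟩
      rw [map_neg]
      exact neg_eq_of_add_eq_zero_right hx
    · rintro ⟨a, ha⟩
      refine ⟨⟨(-a, b), ?_⟩, rfl⟩
      rw [LinearMap.mem_ker, hd_apply, map_neg]
      exact neg_add_eq_zero.mpr ha
  have h_boundary : (Submodule.comap d.ker.subtype
      (LinearMap.range (LinearMap.prod (-q) p))).toAddSubgroup = P.comap g := by
    ext ⟨⟨a, b⟩, hx⟩
    constructor
    · rintro ⟨y, hy⟩
      exact ⟨y, congrArg Prod.snd hy⟩
    · rintro ⟨y, hy⟩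
      replace hy : p y = b := hy
      refine ⟨y, Prod.ext (hp ?_) hy⟩
      change p (-q y) = p a
      rw [LinearMap.mem_ker, hd_apply] at hx
      rw [map_neg, hpq, hy]
      exact neg_eq_of_add_eq_zero_left hx
  have h_range : d.range.toAddSubgroup = P ⊔ Q.range := by
    ext b
    rw [AddSubgroup.mem_sup]
    constructor
    · rintro ⟨x, rfl⟩
      exact ⟨_, ⟨x.1, rfl⟩, _, ⟨x.2, rfl⟩, rfl⟩
    · rintro ⟨_, ⟨x, rfl⟩, _, ⟨y, rfl⟩, rfl⟩
      exact ⟨(x, y), rfl⟩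
  have hH₁ : Nat.card (d.ker ⧸ Submodule.comap d.ker.subtype
      (LinearMap.range (LinearMap.prod (-q) p))) = (P ⊔ Q.range).index := by
    change (Submodule.toAddSubgroup _).index = _
    rw [h_boundary, AddSubgroup.index_comap, hg,
      AddSubgroup.relIndex_comap_eq_index_sup_range P Q hP hPQ]
  have hH₀ : Nat.card (B ⧸ d.range) = (P ⊔ Q.range).index := by
    change (Submodule.toAddSubgroup _).index = _
    rw [h_range]
  have hne : (P ⊔ Q.range).index ≠ 0 := fun h ↦
    hP (Nat.eq_zero_of_zero_dvd (h ▸ AddSubgroup.index_dvd_of_le le_sup_left))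
  exact ⟨Nat.finite_of_card_ne_zero (hH₁ ▸ hne), Nat.finite_of_card_ne_zero (hH₀ ▸ hne),
    hH₁.trans hH₀.symm⟩
end
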